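/- Suppose there exists a probability measure Q equivalent to P on 𝒢 such that F is immersed in G under Q, and let P¹ be any probability measure equivalent to P on 𝒢. Then there exists a probability measure P² equivalent to P on 𝒢 such that F is immersed in G under P² and P² coincides with P¹ on F_∞. (In particular, any process that is an (F,P¹)-martingale is an (F,P²)-martingale, so any martingale measure for an F-adapted price process can be chosen to also satisfy the immersion property.) -/

import Mathlib

open MeasureTheory Set
open scoped NNReal ENNReal

noncomputable section

namespace DefaultTimes

variable {Ω : Type*}

/-- The progressively enlarged filtration
`G_t = ⋂_{u>t} (F_u ∨ σ(τ ∧ s : s ≤ u))`. -/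
def enlargedFiltration {m0 : MeasurableSpace Ω}
    (F : Filtration ℝ≥0 m0) (τ : Ω → ℝ≥0∞) (hτ : Measurable τ) :
    Filtration ℝ≥0 m0 where
  seq t := ⨅ u ∈ Set.Ioi t, (F u ⊔ ⨆ s ∈ Set.Iic u,
      MeasurableSpace.comap (fun ω => min (τ ω) (s : ℝ≥0∞)) inferInstance)
  mono' := fun i j hij => le_iInf₂ fun u hu => iInf₂_le u (lt_of_le_of_lt hij hu)
  le' := fun t => by
    refine le_trans (iInf₂_le (t + 1) (lt_add_of_pos_right t one_pos)) ?_
    exact sup_le (Filtration.le _ _)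
      (iSup₂_le fun s _ => Measurable.comap_le (hτ.min measurable_const))

/-- `F` is immersed in `G` under `μ` ((H)-hypothesis): every `(F,μ)`-martingale is
a `(G,μ)`-martingale. -/
def Immersion {m0 : MeasurableSpace Ω} (F G : Filtration ℝ≥0 m0) (μ : Measure Ω) : Prop :=
  ∀ f : ℝ≥0 → Ω → ℝ, Martingale f F μ → Martingale f G μ

/-- A filtration is contained in its progressive enlargement. -/
lemma le_enlargedFiltration {m0 : MeasurableSpace Ω}
    (F : Filtration ℝ≥0 m0) (τ : Ω → ℝ≥0∞) (hτ : Measurable τ) :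
    F ≤ enlargedFiltration F τ hτ :=
  fun _ => le_iInf₂ fun _ hu => (F.mono (le_of_lt hu)).trans le_sup_left

/-- Under immersion, conditioning an `F_∞`-measurable variable on `G_s` or on `F_s` is the same. -/
lemma Immersion.condExp_eq {m0 : MeasurableSpace Ω} {F G : Filtration ℝ≥0 m0} {μ : Measure Ω}
    [IsFiniteMeasure μ] (h : Immersion F G μ) {X : Ω → ℝ} (hX : Integrable X μ)
    (hXm : StronglyMeasurable[⨆ u, F u] X) (s : ℝ≥0) :
    μ[X | G s] =ᵐ[μ] μ[X | F s] := by
  let F' : Filtration ℕ m0 :=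
    ⟨fun n => F n, fun _ _ hij => F.mono (Nat.cast_le.2 hij), fun n => F.le n⟩
  have hF' : (⨆ u, F u) ≤ ⨆ n, F' n := iSup_le fun u => by
    obtain ⟨n, hn⟩ := exists_nat_ge u
    exact (F.mono hn).trans (le_iSup F' n)
  have hlim := hX.tendsto_eLpNorm_condExp (ℱ := F') (hXm.mono hF')
  have hM : Martingale (fun t => μ[X | F t]) G μ := h _ (martingale_condExp X F μ)
  have hle : ∀ᶠ n : ℕ in Filter.atTop,
      eLpNorm (μ[X | G s] - μ[X | F s]) 1 μ ≤ eLpNorm (μ[X | F' n] - X) 1 μ := by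
    obtain ⟨N, hN⟩ := exists_nat_ge s
    filter_upwards [Filter.eventually_ge_atTop N] with n hn
    have hsn : s ≤ (n : ℝ≥0) := hN.trans (Nat.cast_le.2 hn)
    have hae : μ[X | G s] - μ[X | F s] =ᵐ[μ] - μ[μ[X | F' n] - X | G s] := by
      filter_upwards [hM.2 s n hsn, condExp_sub (m := G s) (integrable_condExp (m := F' n)) hX]
        with ω h1 h2
      simp only [Pi.sub_apply, Pi.neg_apply] at h2 ⊢
      rw [h2, ← h1]
      exact (neg_sub _ _).symm
    rw [eLpNorm_congr_ae hae, eLpNorm_neg]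
    exact eLpNorm_condExp_le_eLpNorm _ le_rfl
  have hzero : eLpNorm (μ[X | G s] - μ[X | F s]) 1 μ = 0 :=
    le_antisymm (ge_of_tendsto hlim hle) zero_le
  rw [eLpNorm_eq_zero_iff
    (integrable_condExp.sub integrable_condExp).aestronglyMeasurable one_ne_zero] at hzero
  filter_upwards [hzero] with ω hω
  exact sub_eq_zero.1 hω

/-- Immersion is preserved by an absolutely continuous change of measure whose density is
`F_∞`-measurable. -/
lemma Immersion.withDensity {m0 : MeasurableSpace Ω} {F G : Filtration ℝ≥0 m0} {μ : Measure Ω}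
    [IsFiniteMeasure μ] (h : Immersion F G μ) (hFG : F ≤ G) {Z : Ω → ℝ≥0∞}
    (hZ : Measurable[⨆ u, F u] Z) (hZ_top : ∀ᵐ ω ∂μ, Z ω < ∞)
    [IsFiniteMeasure (μ.withDensity Z)] :
    Immersion F G (μ.withDensity Z) := by
  intro f hf
  have hZ0 : Measurable Z := hZ.mono (iSup_le F.le) le_rfl
  have hint : ∀ t, Integrable (fun ω => (Z ω).toReal • f t ω) μ := fun t =>
    (integrable_withDensity_iff_integrable_smul' hZ0 hZ_top).1 (hf.integrable t)
  have hmeas : ∀ t, StronglyMeasurable[⨆ u, F u] (fun ω => (Z ω).toReal • f t ω) := fun t =>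
    hZ.ennreal_toReal.stronglyMeasurable.smul ((hf.1 t).mono (le_iSup F t))
  have hset : ∀ t {A : Set Ω}, MeasurableSet A →
      ∫ ω in A, f t ω ∂μ.withDensity Z = ∫ ω in A, (Z ω).toReal • f t ω ∂μ := fun t _ hA =>
    setIntegral_withDensity_eq_setIntegral_toReal_smul hZ0 (ae_restrict_of_ae hZ_top) _ hA
  refine ⟨fun t => (hf.1 t).mono (hFG t), fun s t hst => ?_⟩
  have hF : μ[fun ω => (Z ω).toReal • f s ω | F s] =ᵐ[μ]
      μ[fun ω => (Z ω).toReal • f t ω | F s] := by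
    refine ae_eq_condExp_of_forall_setIntegral_eq (F.le s) (hint t)
      (fun _ _ _ => integrable_condExp.integrableOn) (fun A hA _ => ?_)
      stronglyMeasurable_condExp.aestronglyMeasurable
    rw [setIntegral_condExp (F.le s) (hint s) hA, ← hset s (F.le s A hA),
      ← hset t (F.le s A hA)]
    exact hf.setIntegral_eq hst hA
  have hG : μ[fun ω => (Z ω).toReal • f s ω | G s] =ᵐ[μ]
      μ[fun ω => (Z ω).toReal • f t ω | G s] :=
    (h.condExp_eq (hint s) (hmeas s) s).trans
      (hF.trans (h.condExp_eq (hint t) (hmeas t) s).symm)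
  refine (ae_eq_condExp_of_forall_setIntegral_eq (G.le s) (hf.integrable t)
    (fun _ _ _ => (hf.integrable s).integrableOn) (fun A hA _ => ?_)
    ((hf.1 s).mono (hFG s)).aestronglyMeasurable).symm
  rw [hset s (G.le s A hA), hset t (G.le s A hA), ← setIntegral_condExp (G.le s) (hint s) hA,
    ← setIntegral_condExp (G.le s) (hint t) hA]
  exact integral_congr_ae (ae_restrict_of_ae hG)

/-- The density of `ν` with respect to `μ` on a sub-σ-algebra `m`, as an `m`-measurable function. -/
lemma exists_density_of_absolutelyContinuous {m m0 : MeasurableSpace Ω} (hm : m ≤ m0)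
    {μ ν : Measure Ω} [IsFiniteMeasure μ] [IsFiniteMeasure ν] (hνμ : ν ≪ μ) (hμν : μ ≪ ν) :
    ∃ Z : Ω → ℝ≥0∞, Measurable[m] Z ∧ (∀ᵐ ω ∂μ, Z ω < ∞) ∧ (∀ᵐ ω ∂μ, Z ω ≠ 0) ∧
      ∀ A, MeasurableSet[m] A → μ.withDensity Z A = ν A := by
  have hZm : Measurable[m] ((ν.trim hm).rnDeriv (μ.trim hm)) := Measure.measurable_rnDeriv _ _
  refine ⟨(ν.trim hm).rnDeriv (μ.trim hm), hZm,
    ae_of_ae_trim hm (Measure.rnDeriv_lt_top _ _), ?_, fun A hA => ?_⟩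
  · refine ae_of_ae_trim hm ?_
    filter_upwards [(hμν.trim hm).ae_le (Measure.rnDeriv_pos (hνμ.trim hm))] with ω hω
    exact hω.ne'
  · rw [withDensity_apply _ (hm A hA), ← lintegral_trim hm hZm, ← restrict_trim hm μ hA,
      Measure.setLIntegral_rnDeriv (hνμ.trim hm), trim_measurableSet_eq hm hA]

theorem stmt_8 {m0 : MeasurableSpace Ω} (P : Measure Ω) [IsProbabilityMeasure P]
    (F : Filtration ℝ≥0 m0) (τ : Ω → ℝ≥0∞) (hτ : Measurable τ)
    (hex : ∃ Q : Measure Ω, IsProbabilityMeasure Q ∧ Q ≪ P ∧ P ≪ Q ∧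
        Immersion F (enlargedFiltration F τ hτ) Q)
    (P1 : Measure Ω) [IsProbabilityMeasure P1] (hP1P : P1 ≪ P) (hPP1 : P ≪ P1) :
    ∃ P2 : Measure Ω, IsProbabilityMeasure P2 ∧ P2 ≪ P ∧ P ≪ P2 ∧
      Immersion F (enlargedFiltration F τ hτ) P2 ∧
      ∀ A : Set Ω, MeasurableSet[⨆ u, F u] A → P2 A = P1 A := by
  obtain ⟨Q, hQ, hQP, hPQ, hImm⟩ := hex
  obtain ⟨Z, hZm, hZ_top, hZ_ne, hZ⟩ := exists_density_of_absolutelyContinuous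
    (iSup_le F.le : (⨆ u, F u) ≤ m0) (hP1P.trans hPQ) (hQP.trans hPP1)
  have hprob : IsProbabilityMeasure (Q.withDensity Z) :=
    ⟨by rw [hZ univ MeasurableSet.univ, measure_univ]⟩
  have hZ0 : Measurable Z := hZm.mono (iSup_le F.le) le_rfl
  exact ⟨Q.withDensity Z, hprob, (withDensity_absolutelyContinuous Q Z).trans hQP,
    hPQ.trans (withDensity_absolutelyContinuous' hZ0.aemeasurable hZ_ne),
    hImm.withDensity (le_enlargedFiltration F τ hτ) hZm hZ_top, hZ⟩

end DefaultTimes
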